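/- arXiv:1612.04584 — 4 statements merged into one kernel-verified Lean document; each statement's English description precedes it below -/
import Mathlib

section
/- Let s, n, k be natural numbers with k + s ≤ n + 1 and suppose R satisfies the stable range condition (S_s). Then every unimodular n×k-block for M is matrix reducible. -/
open MulOpposite

variable {R : Type*} [Ring R] [StarRing R] {M : Type*} [AddCommGroup M] [Module Rᵐᵒᵖ M]

/-- An `n×k`-block for `M`: an `n×k` matrix over `R` together with `k` maps `M → R`
(the "last row"). -/
structure Block (R : Type*) [Ring R] (M : Type*) (n k : ℕ) where
  mat : Matrix (Fin n) (Fin k) R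
  maps : Fin k → M → R

/-- The maps in the last row of the block are anti-linear. -/
def Block.IsAntiLinear {n k : ℕ} (A : Block R M n k) : Prop :=
  ∀ j, (∀ x y : M, A.maps j (x + y) = A.maps j x + A.maps j y) ∧
    (∀ (r : R) (x : M), A.maps j (op r • x) = star r * A.maps j x)

/-- A matrix is unimodular if it admits a left inverse. -/
def MatUnimodular {n k : ℕ} (B : Matrix (Fin n) (Fin k) R) : Prop :=
  ∃ L : Matrix (Fin k) (Fin n) R, L * B = 1

/-- A vector `(r_1, …, r_m) ∈ R^m` is unimodular if `Σ a_i r_i = 1` for some `a_i`. -/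
def VecUnimodular {m : ℕ} (r : Fin m → R) : Prop :=
  ∃ a : Fin m → R, ∑ i, a i * r i = 1

/-- `R` satisfies the stable range condition `(S_s)`. -/
def SatisfiesStableRange (R : Type*) [Ring R] (s : ℕ) : Prop :=
  ∀ r : Fin (s + 1) → R, VecUnimodular r →
    ∃ t : Fin s → R, VecUnimodular (fun i : Fin s => r i.castSucc + t i * r (Fin.last s))

/-- A block is unimodular if it admits a left inverse `(r'_{i,l} | m'_i)`. -/
def Block.Unimodular {n k : ℕ} (A : Block R M n k) : Prop :=
  ∃ (r' : Matrix (Fin k) (Fin n) R) (m' : Fin k → M),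
    ∀ i j, (∑ l, r' i l * A.mat l j) + A.maps j (m' i) = if i = j then (1 : R) else 0

/-- A block is matrix reducible if adding `f_j(m_i)` to its matrix part (for suitable
`m_1, …, m_n ∈ M`) produces a unimodular matrix. -/
def Block.MatrixReducible {n k : ℕ} (A : Block R M n k) : Prop :=
  ∃ m : Fin n → M,
    MatUnimodular (Matrix.of fun i j => A.mat i j + A.maps j (m i))

/-- Any generating set of `P` modulo a submodule `N`, consisting of `n` elements, can be
corrected by elements of `N` to a generating set of `P`. -/
def TupleReducible (R : Type*) [Ring R] (P : Type*) [AddCommGroup P] [Module R P] (n : ℕ) :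
    Prop :=
  ∀ (a : Fin n → P) (N : Submodule R P), Submodule.span R (Set.range a) ⊔ N = ⊤ →
    ∃ v : Fin n → P, (∀ i, v i ∈ N) ∧ Submodule.span R (Set.range (a + v)) = ⊤

theorem TupleReducible.of_linearEquiv {R : Type*} [Ring R] {P Q : Type*} [AddCommGroup P]
    [Module R P] [AddCommGroup Q] [Module R Q] {n : ℕ} (e : P ≃ₗ[R] Q)
    (h : TupleReducible R P n) : TupleReducible R Q n := by
  intro a N ha
  obtain ⟨v, hv, hspan⟩ := h (e.symm ∘ a) (N.map (e.symm : Q →ₗ[R] P)) (by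
    have := congrArg (Submodule.map (e.symm : Q →ₗ[R] P)) ha
    rw [Submodule.map_sup, Submodule.map_span, ← Set.range_comp, Submodule.map_top,
      LinearEquiv.range] at this
    exact this)
  refine ⟨e ∘ v, fun i => ?_, ?_⟩
  · obtain ⟨y, hy, hyv⟩ := hv i
    simpa [← hyv] using hy
  · have := congrArg (Submodule.map (e : P →ₗ[R] Q)) hspan
    rw [Submodule.map_span, ← Set.range_comp, Submodule.map_top, LinearEquiv.range] at this
    convert this using 3
    ext i
    simp

theorem tupleReducible_of_satisfiesStableRange {R : Type*} [Ring R] {s : ℕ}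
    (hs : SatisfiesStableRange R s) : TupleReducible R R s := by
  intro a N ha
  have h1 : (1 : R) ∈ Submodule.span R (Set.range a) ⊔ N := ha ▸ Submodule.mem_top
  obtain ⟨y, hy, w, hw, hyw⟩ := Submodule.mem_sup.mp h1
  obtain ⟨c, rfl⟩ := (Submodule.mem_span_range_iff_exists_fun R).mp hy
  obtain ⟨t, d, hd⟩ := hs (Fin.snoc a w) ⟨Fin.snoc c 1, by
    simpa [Fin.sum_univ_castSucc] using hyw⟩
  refine ⟨fun i => t i * w, fun i => N.smul_mem (t i) hw, ?_⟩
  refine (Ideal.eq_top_iff_one _).mpr ?_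
  exact (Submodule.mem_span_range_iff_exists_fun R).mpr ⟨d, by simpa using hd⟩

theorem TupleReducible.succ_self {R : Type*} [Ring R] {n : ℕ} (h : TupleReducible R R n) :
    TupleReducible R R (n + 1) := by
  intro a N ha
  have h1 : (1 : R) ∈ Submodule.span R (Set.range a) ⊔ N := ha ▸ Submodule.mem_top
  obtain ⟨y, hy, w, hw, hyw⟩ := Submodule.mem_sup.mp h1
  obtain ⟨c, rfl⟩ := (Submodule.mem_span_range_iff_exists_fun R).mp hy
  set x := a (Fin.last n)
  set z := c (Fin.last n) * x + w with hz
  obtain ⟨v, hv, hspan⟩ := h (fun i => a i.castSucc) (Submodule.span R {z}) (by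
    refine (Ideal.eq_top_iff_one _).mpr ?_
    rw [← hyw, Fin.sum_univ_castSucc, add_assoc]
    refine Submodule.add_mem_sup ?_ (Submodule.mem_span_singleton_self z)
    exact (Submodule.mem_span_range_iff_exists_fun R).mpr ⟨fun i => c i.castSucc, rfl⟩)
  choose t ht using fun i => Submodule.mem_span_singleton.mp (hv i)
  refine ⟨Fin.snoc (fun i => t i * w) 0, fun i => ?_, ?_⟩
  · refine Fin.lastCases ?_ (fun i => ?_) i
    · simp
    · simpa using N.smul_mem (t i) hw
  · rw [eq_top_iff, ← hspan, Submodule.span_le]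
    rintro _ ⟨i, rfl⟩
    have hx := Submodule.subset_span (R := R) (Set.mem_range_self
      (f := a + (Fin.snoc (fun i => t i * w) 0 : Fin (n + 1) → R)) (Fin.last n))
    have hi := Submodule.subset_span (R := R) (Set.mem_range_self
      (f := a + (Fin.snoc (fun i => t i * w) 0 : Fin (n + 1) → R)) i.castSucc)
    have := Submodule.add_mem _ hi (Submodule.smul_mem _ (t i * c (Fin.last n)) hx)
    rw [SetLike.mem_coe]
    convert this using 1
    simp only [Pi.add_apply, Fin.snoc_castSucc, Fin.snoc_last, add_zero, ← ht, hz, x,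
      smul_eq_mul, mul_add, mul_assoc]
    abel

theorem tupleReducible_self_of_le {R : Type*} [Ring R] {s n : ℕ}
    (hs : SatisfiesStableRange R s) (hn : s ≤ n) : TupleReducible R R n := by
  induction n, hn using Nat.le_induction with
  | base => exact tupleReducible_of_satisfiesStableRange hs
  | succ n _ ih => exact ih.succ_self

/-- If the first coordinates of `a` generate `R`, then elementary operations and the quotient by
an element with first coordinate `1` reduce the correction problem from `R × P` to `P`. -/
theorem exists_span_eq_top_of_span_fst_eq_top {R : Type*} [Ring R] {P : Type*} [AddCommGroup P]
    [Module R P] {n : ℕ} (hR : TupleReducible R R n) (hP : TupleReducible R P n)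
    (a : Fin (n + 1) → R × P) (N : Submodule R (R × P))
    (ha : Submodule.span R (Set.range a) ⊔ N = ⊤)
    (hfst : Submodule.span R (Set.range fun i => (a i).1) = ⊤) :
    ∃ v : Fin (n + 1) → R × P, (∀ i, v i ∈ N) ∧ Submodule.span R (Set.range (a + v)) = ⊤ := by
  set x := a (Fin.last n) with hx
  obtain ⟨w, hw, hwspan⟩ := hR (fun i => (a i.castSucc).1) (Submodule.span R {x.1}) (by
    rw [eq_top_iff, ← hfst, Submodule.span_le]
    rintro _ ⟨i, rfl⟩
    refine Fin.lastCases ?_ (fun i => ?_) i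
    · exact Submodule.mem_sup_right (Submodule.mem_span_singleton_self _)
    · exact Submodule.mem_sup_left (Submodule.subset_span ⟨i, rfl⟩))
  choose t ht using fun i => Submodule.mem_span_singleton.mp (hw i)
  obtain ⟨c, hc⟩ := (Submodule.mem_span_range_iff_exists_fun R).mp
    (show 1 - x.1 ∈ Submodule.span R _ from hwspan ▸ Submodule.mem_top)
  -- the tuple after elementary operations: `b` followed by `z`, where `z.1 = 1`
  set b : Fin n → R × P := fun i => a i.castSucc + t i • x with hb
  set z : R × P := x + ∑ i, c i • b i with hz
  have hz1 : z.1 = 1 := by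
    have : ∑ i, (c i • b i).1 = 1 - x.1 := by
      rw [← hc]
      refine Finset.sum_congr rfl fun i _ => ?_
      simp [hb, ← ht, mul_add]
    simp only [hz, Prod.fst_add, Prod.fst_sum, this]
    abel
  let q : R × P →ₗ[R] P :=
    LinearMap.snd R R P - (LinearMap.toSpanSingleton R P z.2).comp (LinearMap.fst R R P)
  have hq : ∀ y, q y = y.2 - y.1 • z.2 := fun y => rfl
  have hqz : q z = 0 := by simp [hq, hz1]
  have hker : ∀ y, q y = 0 → y ∈ Submodule.span R {z} := by
    intro y hy
    refine Submodule.mem_span_singleton.mpr ⟨y.1, ?_⟩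
    ext
    · simp [hz1]
    · simpa using (sub_eq_zero.mp hy).symm
  have hqsurj : LinearMap.range q = ⊤ :=
    LinearMap.range_eq_top.mpr fun p => ⟨(0, p), by simp [hq]⟩
  have hqspan : Submodule.span R (Set.range (q ∘ b)) ⊔ N.map q = ⊤ := by
    have hbq : ∀ i, q (b i) ∈ Submodule.span R (Set.range (q ∘ b)) :=
      fun i => Submodule.subset_span ⟨i, rfl⟩
    have hxq : q x ∈ Submodule.span R (Set.range (q ∘ b)) := by
      have : q x = - ∑ i, c i • q (b i) := by
        rw [eq_neg_iff_add_eq_zero, ← hqz, hz, map_add, map_sum]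
        simp
      rw [this]
      exact Submodule.neg_mem _ (Submodule.sum_mem _ fun i _ => Submodule.smul_mem _ _ (hbq i))
    rw [eq_top_iff, ← hqsurj, ← Submodule.map_top, ← ha, Submodule.map_sup]
    refine sup_le_sup_right ?_ _
    rw [Submodule.map_span, Submodule.span_le]
    rintro _ ⟨_, ⟨i, rfl⟩, rfl⟩
    refine Fin.lastCases hxq (fun i => ?_) i
    have : q (a i.castSucc) = q (b i) - t i • q x := by simp [hb]
    rw [this]
    exact Submodule.sub_mem _ (hbq i) (Submodule.smul_mem _ _ hxq)
  obtain ⟨v', hv', hv'span⟩ := hP (q ∘ b) (N.map q) hqspan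
  choose v hv hqv using hv'
  set u : R × P := ∑ i, c i • v i with hu
  have huN : u ∈ N := Submodule.sum_mem _ fun i _ => N.smul_mem _ (hv i)
  set d : Fin (n + 1) → R × P := Fin.snoc (fun i => v i + t i • u) (-u) with hd
  refine ⟨d, fun i => ?_, ?_⟩
  · refine Fin.lastCases ?_ (fun i => ?_) i
    · simpa [hd] using huN
    · simpa [hd] using N.add_mem (hv i) (N.smul_mem (t i) huN)
  set S := Submodule.span R (Set.range (a + d)) with hS
  have hxS : x - u ∈ S := Submodule.subset_span ⟨Fin.last n, by simp [hd, hx, sub_eq_add_neg]⟩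
  have hbS : ∀ i, b i + v i ∈ S := by
    intro i
    have h : (a + d) i.castSucc ∈ S := Submodule.subset_span ⟨_, rfl⟩
    convert S.add_mem h (S.smul_mem (t i) hxS) using 1
    simp only [hb, hd, Pi.add_apply, Fin.snoc_castSucc, smul_sub]
    abel
  have hzS : z ∈ S := by
    have h : ∑ i, c i • (b i + v i) ∈ S := S.sum_mem fun i _ => S.smul_mem (c i) (hbS i)
    convert S.add_mem hxS h using 1
    simp only [hz, hu, smul_add, Finset.sum_add_distrib]
    abel
  have hmap : S.map q = ⊤ := by
    rw [eq_top_iff, ← hv'span, Submodule.span_le]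
    rintro _ ⟨i, rfl⟩
    exact ⟨b i + v i, hbS i, by simp [hqv]⟩
  refine eq_top_iff.mpr fun y _ => ?_
  obtain ⟨y', hy', hyy'⟩ : q y ∈ S.map q := hmap ▸ Submodule.mem_top
  have hsub : y - y' ∈ S :=
    (Submodule.span_singleton_le_iff_mem z S).mpr hzS (hker _ (by rw [map_sub, hyy', sub_self]))
  simpa using S.add_mem hsub hy'

theorem TupleReducible.prod {R : Type*} [Ring R] {P : Type*} [AddCommGroup P]
    [Module R P] {n : ℕ} (hR : TupleReducible R R n) (hP : TupleReducible R P n) :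
    TupleReducible R (R × P) (n + 1) := by
  intro a N ha
  obtain ⟨w, hw, hwspan⟩ := hR.succ_self (fun i => (a i).1) (N.map (LinearMap.fst R R P)) (by
    have := congrArg (Submodule.map (LinearMap.fst R R P)) ha
    rw [Submodule.map_sup, Submodule.map_span, ← Set.range_comp, Submodule.map_top,
      LinearMap.range_eq_top.mpr LinearMap.fst_surjective] at this
    exact this)
  choose v hv hvw using hw
  obtain ⟨u, hu, huspan⟩ := exists_span_eq_top_of_span_fst_eq_top hR hP (a + v) N (by
    rw [eq_top_iff, ← ha]
    refine sup_le (Submodule.span_le.mpr ?_) le_sup_right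
    rintro _ ⟨i, rfl⟩
    have h : (a + v) i ∈ Submodule.span R (Set.range (a + v)) := Submodule.subset_span ⟨i, rfl⟩
    simpa using Submodule.add_mem_sup h (N.neg_mem (hv i))) (by
    rw [← hwspan]
    have h : (fun i => ((a + v) i).1) = (fun i => (a i).1) + w :=
      funext fun i => congrArg ((a i).1 + ·) (hvw i)
    rw [h])
  exact ⟨v + u, fun i => N.add_mem (hv i) (hu i), by rwa [← add_assoc]⟩

theorem tupleReducible_pi {R : Type*} [Ring R] {s n k : ℕ}
    (hs : SatisfiesStableRange R s) (hn : k + s ≤ n) : TupleReducible R (Fin (k + 1) → R) n := by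
  induction k generalizing n with
  | zero =>
    exact (tupleReducible_self_of_le hs (by omega)).of_linearEquiv
      (LinearEquiv.funUnique (Fin 1) R R).symm
  | succ k ih =>
    obtain ⟨n, rfl⟩ : ∃ m, n = m + 1 := ⟨n - 1, by omega⟩
    exact ((tupleReducible_self_of_le hs (by omega)).prod (ih (by omega))).of_linearEquiv
      (Fin.consLinearEquiv R fun _ : Fin (k + 2) => R)

theorem matUnimodular_of_span_range_row_eq_top {R : Type*} [Ring R] {n k : ℕ}
    {B : Matrix (Fin n) (Fin k) R} (hB : Submodule.span R (Set.range B.row) = ⊤) :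
    MatUnimodular B := by
  choose L hL using fun i : Fin k => (Submodule.mem_span_range_iff_exists_fun R).mp
    (show Pi.single i (1 : R) ∈ Submodule.span R (Set.range B.row) from hB ▸ Submodule.mem_top)
  refine ⟨Matrix.of L, ?_⟩
  ext i j
  have := congrFun (hL i) j
  simpa [Matrix.mul_apply, Matrix.one_apply, Pi.single_apply, eq_comm] using this

/-- The image of the last row of an anti-linear block is a left submodule of `R ^ k`. -/
def Block.mapsRange {R : Type*} [Ring R] [StarRing R] {M : Type*} [AddCommGroup M]
    [Module Rᵐᵒᵖ M] {n k : ℕ} (A : Block R M n k) (hA : A.IsAntiLinear) :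
    Submodule R (Fin k → R) where
  carrier := Set.range fun m j => A.maps j m
  add_mem' := by
    rintro _ _ ⟨x, rfl⟩ ⟨y, rfl⟩
    exact ⟨x + y, funext fun j => (hA j).1 x y⟩
  zero_mem' := ⟨0, funext fun j => by simpa using (hA j).1 0 0⟩
  smul_mem' := by
    rintro r _ ⟨x, rfl⟩
    exact ⟨op (star r) • x, funext fun j => by simp only [(hA j).2, star_star, Pi.smul_apply, smul_eq_mul]⟩

/-- If `k + s ≤ n + 1` and `R` satisfies the stable range condition
`(S_s)`, then every unimodular `n×k`-block for `M` is matrix reducible. -/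
theorem block_matrixReducible_of_unimodular (R : Type*) [Ring R] [StarRing R]
    (M : Type*) [AddCommGroup M] [Module Rᵐᵒᵖ M] (s n k : ℕ)
    (hns : k + s ≤ n + 1) (hs : SatisfiesStableRange R s)
    (A : Block R M n k) (hA : A.IsAntiLinear) (hAuni : A.Unimodular) :
    A.MatrixReducible := by
  obtain _ | k := k
  · exact ⟨0, 0, Subsingleton.elim _ _⟩
  obtain ⟨r', m', h⟩ := hAuni
  obtain ⟨v, hv, hspan⟩ := tupleReducible_pi (k := k) (n := n) hs (by omega) A.mat.row
      (A.mapsRange hA) (by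
    rw [eq_top_iff, ← (Pi.basisFun R (Fin (k + 1))).span_eq, Submodule.span_le]
    rintro _ ⟨i, rfl⟩
    refine Submodule.mem_sup.mpr ⟨∑ l, r' i l • A.mat.row l, ?_, fun j => A.maps j (m' i),
      ⟨m' i, rfl⟩, ?_⟩
    · exact (Submodule.mem_span_range_iff_exists_fun R).mpr ⟨r' i, rfl⟩
    · ext j
      simpa [Pi.single_apply, eq_comm] using h i j)
  choose m hm using hv
  refine ⟨m, matUnimodular_of_span_range_row_eq_top ?_⟩
  have h : (Matrix.of fun i j => A.mat i j + A.maps j (m i)).row = A.mat.row + v :=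
    funext fun i => congrArg (A.mat.row i + ·) (hm i)
  rwa [h]
end

section
/- Let A be an n×k-block for M, with matrix entries r_{i,j} and anti-linear maps f_1,…,f_k. Then A is matrix reducible if and only if each of the following transformed blocks is matrix reducible: (1) for any v_1,…,v_n ∈ M, the block with matrix entries r_{i,j} + f_j(v_i) and the same maps f_1,…,f_k; (2) for any invertible matrix C ∈ GL_n(R), the block with matrix entries Σ_l C_{i,l}·r_{l,j} and the same maps f_1,…,f_k; (3) for any invertible matrix D ∈ GL_k(R), the block with matrix entries Σ_l r_{i,l}·D_{l,j} and maps f'_j defined by f'_j(m) = Σ_l f_l(m)·D_{l,j}. -/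
open MulOpposite

variable {R : Type*} [Ring R] [StarRing R] {M : Type*} [AddCommGroup M] [Module Rᵐᵒᵖ M]

namespace MatUnimodular

variable {S : Type*} [Ring S] {n k : ℕ} {B : Matrix (Fin n) (Fin k) S}

theorem unit_mul (h : MatUnimodular B) {C : Matrix (Fin n) (Fin n) S} (hC : IsUnit C) :
    MatUnimodular (C * B) := by
  obtain ⟨L, hL⟩ := h
  obtain ⟨C', hC'⟩ := hC.exists_left_inv
  exact ⟨L * C', by rw [Matrix.mul_assoc, ← Matrix.mul_assoc C', hC', Matrix.one_mul, hL]⟩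

theorem mul_unit (h : MatUnimodular B) {D : Matrix (Fin k) (Fin k) S} (hD : IsUnit D) :
    MatUnimodular (B * D) := by
  obtain ⟨L, hL⟩ := h
  obtain ⟨D', hD'⟩ := hD.exists_left_inv
  exact ⟨D' * L, by rw [Matrix.mul_assoc, ← Matrix.mul_assoc L, hL, Matrix.one_mul, hD']⟩

theorem mul_unit_iff {D : Matrix (Fin k) (Fin k) S} (hD : IsUnit D) :
    MatUnimodular (B * D) ↔ MatUnimodular B := by
  refine ⟨fun h => ?_, fun h => h.mul_unit hD⟩
  obtain ⟨u, rfl⟩ := hD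
  simpa [Matrix.mul_assoc] using h.mul_unit u⁻¹.isUnit

end MatUnimodular

namespace Block

variable {n k : ℕ} {A : Block R M n k}

theorem IsAntiLinear.map_sum_smul (hA : A.IsAntiLinear) (j : Fin k) {ι : Type*} (s : Finset ι)
    (c : ι → R) (m : ι → M) :
    A.maps j (∑ l ∈ s, op (star (c l)) • m l) = ∑ l ∈ s, c l * A.maps j (m l) := by
  have h := map_sum (AddMonoidHom.mk' (A.maps j) (hA j).1) (fun l => op (star (c l)) • m l) s
  simpa only [AddMonoidHom.mk'_apply, (hA j).2, star_star] using h

theorem MatrixReducible.add_maps (hA : A.IsAntiLinear) (h : A.MatrixReducible) (v : Fin n → M) :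
    (Block.mk (Matrix.of fun i j => A.mat i j + A.maps j (v i)) A.maps).MatrixReducible := by
  obtain ⟨m, hm⟩ := h
  refine ⟨fun i => -v i + m i, ?_⟩
  convert hm using 4 with i j
  simp only [Matrix.of_apply]
  rw [add_assoc, ← (hA j).1, add_neg_cancel_left]

theorem MatrixReducible.unit_mul (hA : A.IsAntiLinear) (h : A.MatrixReducible)
    {C : Matrix (Fin n) (Fin n) R} (hC : IsUnit C) :
    (Block.mk (C * A.mat) A.maps).MatrixReducible := by
  obtain ⟨m, hm⟩ := h
  refine ⟨fun i => ∑ l, op (star (C i l)) • m l, ?_⟩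
  convert hm.unit_mul hC using 1
  ext i j
  simp only [Matrix.of_apply, Matrix.mul_apply, hA.map_sum_smul, mul_add, Finset.sum_add_distrib]

end Block

/-- Matrix reducibility of a block is invariant under: (1) adding the
values of the last-row maps to the matrix part; (2) left multiplication of the matrix part
by an invertible matrix; (3) right multiplication of the block by an invertible matrix. -/
theorem block_matrixReducible_moves (R : Type*) [Ring R] [StarRing R]
    (M : Type*) [AddCommGroup M] [Module Rᵐᵒᵖ M] {n k : ℕ}
    (A : Block R M n k) (hA : A.IsAntiLinear) :
    (∀ v : Fin n → M,
      (A.MatrixReducible ↔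
        (Block.mk (Matrix.of fun i j => A.mat i j + A.maps j (v i))
          A.maps).MatrixReducible)) ∧
    (∀ C : Matrix (Fin n) (Fin n) R, IsUnit C →
      (A.MatrixReducible ↔ (Block.mk (C * A.mat) A.maps).MatrixReducible)) ∧
    (∀ D : Matrix (Fin k) (Fin k) R, IsUnit D →
      (A.MatrixReducible ↔
        (Block.mk (A.mat * D)
          (fun j m => ∑ l, A.maps l m * D l j)).MatrixReducible)) := by
  refine ⟨fun v => ⟨fun h => h.add_maps hA v, fun h => ?_⟩,
    fun C hC => ⟨fun h => h.unit_mul hA hC, fun h => ?_⟩, fun D hD => exists_congr fun m => ?_⟩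
  · obtain ⟨m, hm⟩ := h
    refine ⟨fun i => v i + m i, ?_⟩
    simpa [(hA _).1, add_assoc] using hm
  · obtain ⟨u, rfl⟩ := hC
    have h' := Block.MatrixReducible.unit_mul (A := Block.mk (u.val * A.mat) A.maps) hA h u⁻¹.isUnit
    simpa [← Matrix.mul_assoc] using h'
  · rw [← MatUnimodular.mul_unit_iff hD]
    congr! 1
    ext i j
    simp [Matrix.mul_apply, add_mul, Finset.sum_add_distrib]
end

section
/- Let s, n, k, l be natural numbers with k + s = n + 1 and l > 0, and suppose R satisfies the stable range condition (S_s). Let A be a unimodular (n+l)×k-block for M, with matrix entries r_{i,j} (1 ≤ i ≤ n+l, 1 ≤ j ≤ k) and anti-linear maps f_1,…,f_k. Then there exist m_1,…,m_n ∈ M such that the (n+l)×k matrix B with entries B_{i,j} = r_{i,j} + f_j(m_i) for 1 ≤ i ≤ n and B_{i,j} = r_{i,j} for n < i ≤ n+l is unimodular. -/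
open MulOpposite

variable {R : Type*} [Ring R] [StarRing R] {M : Type*} [AddCommGroup M] [Module Rᵐᵒᵖ M]

open Submodule

theorem vecUnimodular_iff_span_eq_top {R : Type*} [Ring R] {m : ℕ} (b : Fin m → R) :
    VecUnimodular b ↔ span R (Set.range b) = ⊤ := by
  rw [← Ideal.span, Ideal.eq_top_iff_one, Ideal.span, mem_span_range_iff_exists_fun]
  rfl

/-- Under `(S_s)`, a column of length at least `s` that generates `R` together with a left ideal
`I` generates `R` after adding suitable elements of `I` to its entries. -/
theorem exists_span_add_eq_top_of_stableRange {R : Type*} [Ring R] {s m : ℕ}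
    (hs : SatisfiesStableRange R s) (hsm : s ≤ m) (b : Fin m → R) (I : Submodule R R)
    (h : span R (Set.range b) ⊔ I = ⊤) :
    ∃ v : Fin m → R, (∀ i, v i ∈ I) ∧ span R (Set.range fun i => b i + v i) = ⊤ := by
  induction m, hsm using Nat.le_induction generalizing I with
  | base =>
    obtain ⟨y, hy, c, hc, hyc⟩ := mem_sup.1 (h ▸ mem_top : (1 : R) ∈ span R (Set.range b) ⊔ I)
    obtain ⟨a, ha⟩ := (mem_span_range_iff_exists_fun R).1 hy
    obtain ⟨t, ht⟩ := hs (Fin.snoc b c) ⟨Fin.snoc a 1, by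
      simpa [Fin.sum_univ_castSucc, ← ha] using hyc⟩
    exact ⟨fun i => t i * c, fun i => I.smul_mem _ hc, by
      simpa using (vecUnimodular_iff_span_eq_top _).1 ht⟩
  | succ m _ ih =>
    obtain ⟨y, hy, c, hc, hyc⟩ := mem_sup.1 (h ▸ mem_top : (1 : R) ∈ span R (Set.range b) ⊔ I)
    obtain ⟨a, ha⟩ := (mem_span_range_iff_exists_fun R).1 hy
    rw [Fin.sum_univ_castSucc] at ha
    obtain ⟨v, hv, hspan⟩ := ih (fun i => b i.castSucc)
      (span R {a (Fin.last m) * b (Fin.last m) + c}) (by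
        refine (Ideal.eq_top_iff_one _).2 (mem_sup.2 ⟨_, (mem_span_range_iff_exists_fun R).2
          ⟨fun i => a i.castSucc, rfl⟩, _, mem_span_singleton_self _, ?_⟩)
        rw [← hyc, ← ha]
        simp [add_assoc])
    choose t ht using fun i => mem_span_singleton.1 (hv i)
    refine ⟨Fin.snoc (fun i => t i * c) 0, fun i => ?_, ?_⟩
    · refine Fin.lastCases ?_ (fun i => ?_) i
      · simp
      · simpa using I.smul_mem (t i) hc
    · rw [eq_top_iff, ← hspan, span_le]
      rintro _ ⟨i, rfl⟩
      rw [SetLike.mem_coe]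
      have hi := subset_span (R := R) (Set.mem_range_self
        (f := fun i => b i + (Fin.snoc (fun i => t i * c) 0 : Fin (m + 1) → R) i) i.castSucc)
      have hl := subset_span (R := R) (Set.mem_range_self
        (f := fun i => b i + (Fin.snoc (fun i => t i * c) 0 : Fin (m + 1) → R) i) (Fin.last m))
      convert add_mem hi (smul_mem _ (t i * a (Fin.last m)) hl) using 1
      simp [← ht, mul_add, mul_assoc]
      abel

/-- The projection `R^(k+1) → R^k` killing a vector `x` whose zeroth entry is `1`. -/
def projAlong {R : Type*} [Ring R] {k : ℕ} (x : Fin (k + 1) → R) :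
    (Fin (k + 1) → R) →ₗ[R] (Fin k → R) where
  toFun y := fun j => y j.succ - y 0 * x j.succ
  map_add' y z := by ext j; simp [add_mul]; abel
  map_smul' c y := by ext j; simp [mul_sub, mul_assoc]

theorem projAlong_surjective {R : Type*} [Ring R] {k : ℕ} (x : Fin (k + 1) → R) :
    Function.Surjective (projAlong x) := fun y => ⟨Fin.cons 0 y, by ext j; simp [projAlong]⟩

theorem ker_projAlong_le {R : Type*} [Ring R] {k : ℕ} {x : Fin (k + 1) → R} (hx : x 0 = 1) :
    LinearMap.ker (projAlong x) ≤ span R {x} := by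
  intro y hy
  refine mem_span_singleton.2 ⟨y 0, ?_⟩
  ext j
  refine Fin.cases (by simp [hx]) (fun j => ?_) j
  exact (sub_eq_zero.1 (congrFun (LinearMap.mem_ker.1 hy) j)).symm

theorem projAlong_self {R : Type*} [Ring R] {k : ℕ} {x : Fin (k + 1) → R} (hx : x 0 = 1) :
    projAlong x x = 0 := by
  ext j
  simp [projAlong, hx]

/-- Under `(S_s)`, at least `k + s` rows that generate `R^(k+1)` together with a submodule `F`
generate `R^(k+1)` after adding suitable elements of `F` to them. -/
theorem exists_span_rows_add_eq_top_of_stableRange {R : Type*} [Ring R] {s : ℕ}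
    (hs : SatisfiesStableRange R s) (k n : ℕ) (hn : k + s ≤ n) (r : Fin n → Fin (k + 1) → R)
    (F : Submodule R (Fin (k + 1) → R)) (h : span R (Set.range r) ⊔ F = ⊤) :
    ∃ v : Fin n → Fin (k + 1) → R,
      (∀ i, v i ∈ F) ∧ span R (Set.range fun i => r i + v i) = ⊤ := by
  induction k generalizing n with
  | zero =>
    let e : (Fin 1 → R) ≃ₗ[R] R := LinearEquiv.funUnique (Fin 1) R R
    obtain ⟨v, hv, hspan⟩ := exists_span_add_eq_top_of_stableRange hs (by omega : s ≤ n)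
      (fun i => e (r i)) (F.map e.toLinearMap) (by
        have := congrArg (map e.toLinearMap) h
        rwa [Submodule.map_sup, map_span, ← Set.range_comp, Submodule.map_top,
          LinearEquiv.range] at this)
    choose w hw hwv using hv
    refine ⟨w, hw, map_injective_of_injective e.injective (f := e.toLinearMap) ?_⟩
    rw [map_span, ← Set.range_comp, Submodule.map_top, LinearEquiv.range, ← hspan]
    congr 2
    ext i
    simp [← hwv]
  | succ k ih =>
    obtain ⟨n, rfl⟩ : ∃ n', n = n' + 1 := ⟨n - 1, by omega⟩
    let φ : (Fin (k + 2) → R) →ₗ[R] R := LinearMap.proj 0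
    have hφ : Function.Surjective φ := LinearMap.proj_surjective 0
    obtain ⟨v₀, hv₀, hspan₀⟩ := exists_span_add_eq_top_of_stableRange hs (by omega : s ≤ n + 1)
      (fun i => φ (r i)) (F.map φ) (by
        have := congrArg (map φ) h
        rwa [Submodule.map_sup, map_span, ← Set.range_comp, Submodule.map_top,
          LinearMap.range_eq_top.2 hφ] at this)
    choose w₀ hw₀ hwv₀ using hv₀
    -- The rows `q` have a unimodular zeroth column.
    set q : Fin (n + 1) → Fin (k + 2) → R := fun i => r i + w₀ i with hq
    have hqF : span R (Set.range q) ⊔ F = ⊤ := by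
      rw [eq_top_iff, ← h]
      refine sup_le (span_le.2 ?_) le_sup_right
      rintro _ ⟨i, rfl⟩
      have : r i = q i - w₀ i := by simp [hq]
      rw [this]
      exact sub_mem (mem_sup_left (subset_span ⟨i, rfl⟩)) (mem_sup_right (hw₀ i))
    have hqcol : span R (Set.range fun i => φ (q i)) = ⊤ := by
      rw [← hspan₀]
      congr 2
      ext i
      simp [hq, ← hwv₀]
    obtain ⟨v₁, hv₁, hspan₁⟩ := exists_span_add_eq_top_of_stableRange hs (by omega : s ≤ n)
      (fun i : Fin n => φ (q i.castSucc)) (span R {φ (q (Fin.last n))}) (by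
        rw [eq_top_iff, ← hqcol, span_le]
        rintro _ ⟨i, rfl⟩
        refine Fin.lastCases ?_ (fun i => ?_) i
        · exact mem_sup_right (mem_span_singleton_self _)
        · exact mem_sup_left (subset_span ⟨i, rfl⟩))
    choose t ht using fun i => mem_span_singleton.1 (hv₁ i)
    obtain ⟨a, ha⟩ := (mem_span_range_iff_exists_fun R).1
      (hspan₁ ▸ mem_top : (1 : R) ∈ span R _)
    -- Row operations turn the last row into a row `x` with zeroth entry `1`.
    set p : Fin n → Fin (k + 2) → R := fun i => q i.castSucc + t i • q (Fin.last n) with hp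
    set d : R := 1 - φ (q (Fin.last n)) with hd
    set x : Fin (k + 2) → R := q (Fin.last n) + d • ∑ i, a i • p i with hx
    have hx0 : x 0 = 1 := by
      have hsum : φ (∑ i, a i • p i) = 1 := by
        rw [← ha, map_sum]
        simp [hp, ← ht, mul_add]
      change φ x = 1
      rw [hx, map_add, map_smul, hsum]
      simp [hd]
    have hpx : span R (Set.range p) ⊔ span R {x} ⊔ F = ⊤ := by
      rw [eq_top_iff, ← hqF]
      refine sup_le_sup_right (span_le.2 ?_) F
      have hpm : ∀ i, p i ∈ span R (Set.range p) ⊔ span R {x} := fun i =>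
        mem_sup_left (subset_span ⟨i, rfl⟩)
      have hlast : q (Fin.last n) ∈ span R (Set.range p) ⊔ span R {x} := by
        have : q (Fin.last n) = x - d • ∑ i, a i • p i := by simp [hx]
        rw [this]
        exact sub_mem (mem_sup_right (mem_span_singleton_self _))
          (smul_mem _ _ (sum_mem fun i _ => smul_mem _ _ (hpm i)))
      rintro _ ⟨i, rfl⟩
      refine Fin.lastCases hlast (fun i => ?_) i
      have : q i.castSucc = p i - t i • q (Fin.last n) := by simp [hp]
      rw [this]
      exact sub_mem (hpm i) (smul_mem _ _ hlast)
    obtain ⟨v, hv, hspan⟩ := ih n (by omega) (fun i => projAlong x (p i)) (F.map (projAlong x))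
      (by
        have := congrArg (map (projAlong x)) hpx
        rwa [Submodule.map_sup, Submodule.map_sup, map_span, map_span, ← Set.range_comp,
          Submodule.map_top, LinearMap.range_eq_top.2 (projAlong_surjective x),
          Set.image_singleton, projAlong_self hx0, span_zero_singleton, sup_bot_eq] at this)
    choose w hw hwv using hv
    have hgen : span R (Set.range fun i => p i + w i) ⊔ span R {x} = ⊤ := by
      rw [eq_top_iff]
      refine le_trans ?_ (sup_le_sup_left (ker_projAlong_le hx0) _)
      rw [← comap_map_eq, map_span, ← Set.range_comp]
      have : (projAlong x ∘ fun i => p i + w i) = fun i => projAlong x (p i) + v i := by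
        ext1 i
        simp [← hwv]
      rw [this, hspan, comap_top]
    -- Undo the row operations.
    set u : Fin (k + 2) → R := -(d • ∑ i, a i • w i) with hu
    have huF : u ∈ F := neg_mem (smul_mem _ _ (sum_mem fun i _ => smul_mem _ _ (hw i)))
    set z : Fin (n + 1) → Fin (k + 2) → R :=
      Fin.snoc (α := fun _ => Fin (k + 2) → R) (fun i => w i - t i • u) u with hz
    refine ⟨fun i => w₀ i + z i, fun i => add_mem (hw₀ i) ?_, ?_⟩
    · refine Fin.lastCases ?_ (fun i => ?_) i
      · simpa [hz] using huF
      · simpa [hz] using sub_mem (hw i) (smul_mem _ (t i) huF)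
    · have hqz : (fun i => r i + (w₀ i + z i)) = fun i => q i + z i := by
        ext1 i
        simp [hq, add_assoc]
      rw [hqz, eq_top_iff, ← hgen]
      have hmem : ∀ i, q i + z i ∈ span R (Set.range fun i => q i + z i) := fun i =>
        subset_span ⟨i, rfl⟩
      have hpw : ∀ i, p i + w i ∈ span R (Set.range fun i => q i + z i) := fun i => by
        convert add_mem (hmem i.castSucc) (smul_mem _ (t i) (hmem (Fin.last n))) using 1
        simp only [hz, hp, Fin.snoc_castSucc, Fin.snoc_last, smul_add]
        abel
      refine sup_le (span_le.2 ?_) (span_le.2 ?_)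
      · rintro _ ⟨i, rfl⟩
        exact hpw i
      · rw [Set.singleton_subset_iff, SetLike.mem_coe]
        convert add_mem (hmem (Fin.last n))
          (smul_mem _ d (sum_mem fun i (_ : i ∈ Finset.univ) => smul_mem _ (a i) (hpw i))) using 1
        simp only [hz, hx, hu, Fin.snoc_last, smul_add, Finset.sum_add_distrib]
        abel

theorem matUnimodular_of_span_rows_eq_top {R : Type*} [Ring R] {n k : ℕ}
    (B : Matrix (Fin n) (Fin k) R) (h : span R (Set.range fun i => B i) = ⊤) :
    MatUnimodular B := by
  choose L hL using fun i : Fin k => (mem_span_range_iff_exists_fun R).1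
    (h ▸ mem_top : (Pi.single i 1 : Fin k → R) ∈ span R (Set.range fun i => B i))
  refine ⟨Matrix.of L, ?_⟩
  ext i j
  have := congrFun (hL i) j
  simpa [Matrix.mul_apply, Matrix.one_apply, Pi.single_apply, eq_comm] using this

/-- The submodule of `R^k` consisting of the rows `(f_1(m), …, f_k(m))`. -/
def Block.mapRows {R : Type*} [Ring R] [StarRing R] {M : Type*} [AddCommGroup M] [Module Rᵐᵒᵖ M]
    {n k : ℕ} (A : Block R M n k) (hA : A.IsAntiLinear) : Submodule R (Fin k → R) where
  carrier := Set.range fun m j => A.maps j m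
  add_mem' := by
    rintro _ _ ⟨x, rfl⟩ ⟨y, rfl⟩
    exact ⟨x + y, funext fun j => (hA j).1 x y⟩
  zero_mem' := ⟨0, funext fun j => by simpa using (hA j).1 0 0⟩
  smul_mem' := by
    rintro c _ ⟨x, rfl⟩
    exact ⟨op (star c) • x, funext fun j => by simpa using (hA j).2 (star c) x⟩

theorem Block.Unimodular.span_rows_sup_mapRows {R : Type*} [Ring R] [StarRing R] {M : Type*}
    [AddCommGroup M] [Module Rᵐᵒᵖ M] {n k : ℕ} {A : Block R M n k} (hAuni : A.Unimodular)
    (hA : A.IsAntiLinear) : span R (Set.range fun i => A.mat i) ⊔ A.mapRows hA = ⊤ := by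
  obtain ⟨r', m', h⟩ := hAuni
  rw [eq_top_iff, ← (Pi.basisFun R (Fin k)).span_eq, span_le]
  rintro _ ⟨i, rfl⟩
  refine mem_sup.2 ⟨∑ l, r' i l • A.mat l, sum_mem fun l _ => smul_mem _ _ (subset_span ⟨l, rfl⟩),
    _, ⟨m' i, rfl⟩, ?_⟩
  ext j
  simpa [Pi.single_apply, eq_comm] using h i j

/-- Let `k + s = n + 1`, `l > 0` and suppose `R` satisfies the stable
range condition `(S_s)`. For every unimodular `(n+l)×k`-block `A` there are
`m_1, …, m_n ∈ M` such that the `(n+l)×k` matrix obtained from the matrix part of `A` by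
adding `f_j(m_i)` to the entry `(i,j)` for `i ≤ n` (and keeping the last `l` rows) is
unimodular. -/
theorem block_reduction_keeping_last_rows (R : Type*) [Ring R] [StarRing R]
    (M : Type*) [AddCommGroup M] [Module Rᵐᵒᵖ M] (s n k l : ℕ)
    (hns : k + s = n + 1) (hl : 0 < l) (hs : SatisfiesStableRange R s)
    (A : Block R M (n + l) k) (hA : A.IsAntiLinear) (hAuni : A.Unimodular) :
    ∃ m : Fin n → M,
      MatUnimodular (Matrix.of fun (i : Fin (n + l)) (j : Fin k) =>
        if h : (i : ℕ) < n then A.mat i j + A.maps j (m ⟨i, h⟩) else A.mat i j) := by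
  cases k with
  | zero => exact ⟨0, 0, Subsingleton.elim _ _⟩
  | succ k =>
    let C : Submodule R (Fin (k + 1) → R) := span R (Set.range fun i => A.mat (Fin.natAdd n i))
    obtain ⟨v, hv, hspan⟩ := exists_span_rows_add_eq_top_of_stableRange hs k n (by omega)
      (fun i => A.mat (Fin.castAdd l i)) (A.mapRows hA ⊔ C) (by
        rw [eq_top_iff, ← hAuni.span_rows_sup_mapRows hA]
        refine sup_le (span_le.2 ?_) (le_sup_left.trans le_sup_right)
        rintro _ ⟨i, rfl⟩
        refine Fin.addCases (fun i => ?_) (fun i => ?_) i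
        · exact mem_sup_left (subset_span ⟨i, rfl⟩)
        · exact mem_sup_right (mem_sup_right (subset_span ⟨i, rfl⟩)))
    choose y hy c hc hyc using fun i => mem_sup.1 (hv i)
    choose m hm using hy
    refine ⟨m, matUnimodular_of_span_rows_eq_top _ ?_⟩
    set B : Matrix (Fin (n + l)) (Fin (k + 1)) R := Matrix.of fun i j =>
      if h : (i : ℕ) < n then A.mat i j + A.maps j (m ⟨i, h⟩) else A.mat i j with hB
    have hCB : C ≤ span R (Set.range fun i => B i) := by
      refine span_le.2 ?_
      rintro _ ⟨i, rfl⟩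
      refine subset_span ⟨Fin.natAdd n i, ?_⟩
      ext j
      simp [hB]
    rw [eq_top_iff, ← hspan, span_le]
    rintro _ ⟨i, rfl⟩
    have hi : B (Fin.castAdd l i) = A.mat (Fin.castAdd l i) + y i := by
      ext j
      simp [hB, ← hm]
    change A.mat (Fin.castAdd l i) + v i ∈ _
    rw [← hyc, ← add_assoc, ← hi]
    exact add_mem (subset_span ⟨_, rfl⟩) (hCB (hc i))
end

section
/- Let s, n, k, l be natural numbers with k + s = n + 1 and l > 0, and suppose R satisfies the stable range condition (S_s). Let A be a unimodular (n+l)×k-block for M, with matrix entries r_{i,j} (1 ≤ i ≤ n+l, 1 ≤ j ≤ k) and anti-linear maps f_1,…,f_k. Then there exist m_1,…,m_n ∈ M and an n×l matrix Q with entries in R such that the n×k matrix B_1 with entries (B_1)_{i,j} = r_{i,j} + Σ_{t=1}^{l} Q_{i,t}·r_{n+t,j} + f_j(m_i) is unimodular. -/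
open MulOpposite

variable {R : Type*} [Ring R] [StarRing R] {M : Type*} [AddCommGroup M] [Module Rᵐᵒᵖ M]

/-- Every family of `n` vectors that generates `V` modulo a submodule `N` can be moved by elements
of `N` so as to generate `V`. -/
def GeneratorsLift (R : Type*) [Ring R] (V : Type*) [AddCommGroup V] [Module R V] (n : ℕ) : Prop :=
  ∀ (v : Fin n → V) (N : Submodule R V), Submodule.span R (Set.range v) ⊔ N = ⊤ →
    ∃ x : Fin n → V, (∀ i, x i ∈ N) ∧ Submodule.span R (Set.range (v + x)) = ⊤

section GeneratorsLift

open Submodule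

variable {R : Type*} [Ring R]

theorem span_eq_top_iff_vecUnimodular {n : ℕ} (v : Fin n → R) :
    span R (Set.range v) = ⊤ ↔ VecUnimodular v := by
  rw [← Ideal.span, Ideal.eq_top_iff_one, Ideal.span, mem_span_range_iff_exists_fun]
  simp [VecUnimodular]

theorem SatisfiesStableRange.generatorsLift {s : ℕ} (hs : SatisfiesStableRange R s) :
    GeneratorsLift R R s := by
  intro v N h
  have h1 : (1 : R) ∈ span R (Set.range v) ⊔ N := h ▸ mem_top
  obtain ⟨a, ha, y, hy, hay⟩ := mem_sup.1 h1
  obtain ⟨c, rfl⟩ := mem_span_range_iff_exists_fun R |>.1 ha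
  obtain ⟨t, ht⟩ := hs (Fin.snoc v y) ⟨Fin.snoc c 1, by
    simpa [Fin.sum_univ_castSucc] using hay⟩
  refine ⟨fun i => t i • y, fun i => N.smul_mem _ hy, ?_⟩
  rw [span_eq_top_iff_vecUnimodular]
  simpa [Pi.add_def] using ht

theorem GeneratorsLift.succ {n : ℕ} (hn : GeneratorsLift R R n) : GeneratorsLift R R (n + 1) := by
  intro v N h
  have h1 : (1 : R) ∈ span R (Set.range v) ⊔ N := h ▸ mem_top
  obtain ⟨a, ha, y, hy, hay⟩ := mem_sup.1 h1
  obtain ⟨c, rfl⟩ := mem_span_range_iff_exists_fun R |>.1 ha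
  rw [Fin.sum_univ_castSucc, add_assoc] at hay
  set z := c (Fin.last n) • v (Fin.last n) + y with hz
  obtain ⟨x, hx, hspan⟩ := hn (fun i => v i.castSucc) (span R {z}) (by
    refine Ideal.eq_top_iff_one _ |>.2 ?_
    rw [← hay]
    refine add_mem (mem_sup_left (sum_mem fun i _ => smul_mem _ _ (subset_span ⟨i, rfl⟩)))
      (mem_sup_right (mem_span_singleton_self z)))
  choose t ht using fun i => mem_span_singleton.1 (hx i)
  refine ⟨Fin.snoc (fun i => t i • y) 0, fun i => ?_, ?_⟩
  · induction i using Fin.lastCases with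
    | last => simp
    | cast i => simpa using N.smul_mem (t i) hy
  · rw [eq_top_iff, ← hspan, span_le]
    rintro _ ⟨i, rfl⟩
    set S := span R (Set.range (v + Fin.snoc (fun i => t i • y) 0)) with hS
    have hlast : v (Fin.last n) ∈ S := subset_span ⟨Fin.last n, by simp⟩
    have hi : v i.castSucc + t i • y ∈ S := subset_span ⟨i.castSucc, by simp⟩
    have heq : v i.castSucc + x i =
        (v i.castSucc + t i • y) + (t i * c (Fin.last n)) • v (Fin.last n) := by
      rw [← ht i, hz, smul_add, smul_smul]; abel
    change v i.castSucc + x i ∈ S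
    rw [heq]
    exact add_mem hi (smul_mem _ _ hlast)

theorem GeneratorsLift.of_le {s n : ℕ} (hsn : s ≤ n) (hs : GeneratorsLift R R s) :
    GeneratorsLift R R n := by
  induction n, hsn using Nat.le_induction with
  | base => exact hs
  | succ n _ ih => exact ih.succ

theorem map_span_range_sup {V W : Type*} [AddCommGroup V] [Module R V] [AddCommGroup W]
    [Module R W] {ι : Type*} {v : ι → V} {N : Submodule R V} (h : span R (Set.range v) ⊔ N = ⊤)
    (f : V →ₗ[R] W) (hf : Function.Surjective f) :
    span R (Set.range (f ∘ v)) ⊔ N.map f = ⊤ := by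
  rw [Set.range_comp, ← map_span, ← Submodule.map_sup, h, Submodule.map_top,
    LinearMap.range_eq_top.2 hf]

theorem span_range_add_sup {V : Type*} [AddCommGroup V] [Module R V] {ι : Type*} {v x : ι → V}
    {N : Submodule R V} (h : span R (Set.range v) ⊔ N = ⊤) (hx : ∀ i, x i ∈ N) :
    span R (Set.range (v + x)) ⊔ N = ⊤ := by
  rw [eq_top_iff, ← h]
  refine sup_le (span_le.2 ?_) le_sup_right
  rintro _ ⟨i, rfl⟩
  have := sub_mem (mem_sup_left (subset_span (R := R) (Set.mem_range_self (f := v + x) i)))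
    (mem_sup_right (hx i))
  simpa using this

theorem GeneratorsLift.of_linearEquiv {V W : Type*} [AddCommGroup V] [Module R V] [AddCommGroup W]
    [Module R W] {n : ℕ} (hn : GeneratorsLift R V n) (e : V ≃ₗ[R] W) : GeneratorsLift R W n := by
  intro v N h
  obtain ⟨x, hx, hspan⟩ := hn _ _ (map_span_range_sup h e.symm.toLinearMap e.symm.surjective)
  refine ⟨e ∘ x, fun i => ?_, ?_⟩
  · obtain ⟨y, hy, hyx⟩ := hx i
    simpa [← hyx] using hy
  · have heq : v + e ∘ x = e ∘ (e.symm.toLinearMap ∘ v + x) := by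
      ext i; simp
    rw [heq, Set.range_comp, ← LinearEquiv.coe_coe, ← map_span, hspan, Submodule.map_top,
      LinearEquiv.range]

theorem GeneratorsLift.pi_succ {n k : ℕ} (hR : GeneratorsLift R R n)
    (hk : GeneratorsLift R (Fin k → R) n) : GeneratorsLift R (Fin (k + 1) → R) (n + 1) := by
  intro v₀ N h₀
  let π : (Fin (k + 1) → R) →ₗ[R] R := LinearMap.proj 0
  -- make the first column unimodular
  obtain ⟨x', hx', hcol⟩ := hR.succ _ _ (map_span_range_sup h₀ π (LinearMap.proj_surjective 0))
  choose x hx hxx' using hx'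
  set v := v₀ + x with hv
  have h : span R (Set.range v) ⊔ N = ⊤ := span_range_add_sup h₀ hx
  have hcol' : span R (Set.range fun i => v i 0) = ⊤ := by
    rw [← hcol]; congr 2; ext i; simp [hv, ← hxx', π]
  -- make it unimodular without its last entry
  obtain ⟨t', ht', htop⟩ := hR (fun i => v i.castSucc 0) (span R {v (Fin.last n) 0}) (by
    rw [eq_top_iff, ← hcol', span_le]
    rintro _ ⟨i, rfl⟩
    induction i using Fin.lastCases with
    | last => exact mem_sup_right (mem_span_singleton_self _)
    | cast i => exact mem_sup_left (subset_span ⟨i, rfl⟩))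
  choose t ht using fun i => mem_span_singleton.1 (ht' i)
  let u : Fin n → Fin (k + 1) → R := fun i => v i.castSucc + t i • v (Fin.last n)
  obtain ⟨b, hb⟩ : VecUnimodular fun i => u i 0 := by
    rw [← span_eq_top_iff_vecUnimodular, ← htop]; congr 2; ext i; simp [u, ← ht]
  let d : Fin n → R := fun i => (1 - v (Fin.last n) 0) * b i
  -- a vector in the span of `v` with first coordinate `1`
  let w : Fin (k + 1) → R := v (Fin.last n) + ∑ i, d i • u i
  have hw : w 0 = 1 := by
    simp [w, d, mul_assoc, ← Finset.mul_sum, hb]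
  let τ : (Fin (k + 1) → R) →ₗ[R] (Fin k → R) :=
    { toFun := fun z j => z j.succ - z 0 * w j.succ
      map_add' := fun y z => by ext j; simp [add_mul]; abel
      map_smul' := fun r z => by ext j; simp [mul_sub, mul_assoc] }
  have hτ_surj : Function.Surjective τ := fun z => ⟨Fin.cons 0 z, by ext j; simp [τ]⟩
  have hτ_ker : ∀ z, τ z = 0 → z = z 0 • w := fun z hz => by
    ext j
    induction j using Fin.cases with
    | zero => simp [hw]
    | succ j => simpa [τ, sub_eq_zero] using congrFun hz j
  have hτw : τ w = 0 := by ext j; simp [τ, hw]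
  have hτ_last : τ (v (Fin.last n)) = - ∑ i, d i • τ (u i) := by
    rw [eq_neg_iff_add_eq_zero, ← hτw]; simp [w]
  obtain ⟨y', hy', hspan⟩ := hk (τ ∘ u) (N.map τ) (by
    rw [eq_top_iff, ← map_span_range_sup h τ hτ_surj]
    refine sup_le (span_le.2 ?_) le_sup_right
    have hu : ∀ i, τ (u i) ∈ span R (Set.range (τ ∘ u)) := fun i => subset_span ⟨i, rfl⟩
    have hlast : τ (v (Fin.last n)) ∈ span R (Set.range (τ ∘ u)) := by
      rw [hτ_last]
      exact neg_mem (sum_mem fun i _ => smul_mem _ _ (hu i))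
    rintro _ ⟨i, rfl⟩
    refine mem_sup_left ?_
    induction i using Fin.lastCases with
    | last => exact hlast
    | cast i =>
      have := sub_mem (hu i) (smul_mem _ (t i) hlast)
      simpa [u] using this)
  choose y hy hyy' using hy'
  let e := ∑ i, d i • y i
  have he : e ∈ N := sum_mem fun i _ => N.smul_mem _ (hy i)
  let x₁ : Fin (n + 1) → Fin (k + 1) → R := Fin.snoc (fun i => y i + t i • e) (-e)
  refine ⟨x + x₁, fun i => add_mem (hx i) ?_, ?_⟩
  · induction i using Fin.lastCases with
    | last => simpa [x₁] using he
    | cast i => simpa [x₁] using add_mem (hy i) (N.smul_mem (t i) he)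
  rw [← add_assoc, ← hv]
  set S := span R (Set.range (v + x₁)) with hS
  have hlast : v (Fin.last n) - e ∈ S := subset_span ⟨Fin.last n, by simp [x₁, sub_eq_add_neg]⟩
  have hu : ∀ i, u i + y i ∈ S := fun i => by
    have hi : v i.castSucc + (y i + t i • e) ∈ S := subset_span ⟨i.castSucc, by simp [x₁]⟩
    have heq : u i + y i = v i.castSucc + (y i + t i • e) + t i • (v (Fin.last n) - e) := by
      simp only [u, smul_sub]; abel
    rw [heq]
    exact add_mem hi (smul_mem _ _ hlast)
  have hwS : w ∈ S := by
    have heq : w = v (Fin.last n) - e + ∑ i, d i • (u i + y i) := by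
      simp only [w, e, smul_add, Finset.sum_add_distrib]; abel
    rw [heq]
    exact add_mem hlast (sum_mem fun i _ => smul_mem _ _ (hu i))
  refine eq_top_iff'.2 fun z => ?_
  have hz : τ z ∈ span R (Set.range (τ ∘ u + y')) := hspan ▸ mem_top
  obtain ⟨c, hc⟩ := mem_span_range_iff_exists_fun R |>.1 hz
  have hker := hτ_ker (z - ∑ i, c i • (u i + y i)) (by
    rw [map_sub, sub_eq_zero, ← hc]; simp [hyy'])
  rw [← sub_add_cancel z (∑ i, c i • (u i + y i)), hker]
  exact add_mem (smul_mem _ _ hwS) (sum_mem fun i _ => smul_mem _ _ (hu i))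

theorem SatisfiesStableRange.generatorsLift_pi {s : ℕ} (hs : SatisfiesStableRange R s) {n k : ℕ}
    (hns : k + s = n + 1) : GeneratorsLift R (Fin k → R) n := by
  induction k generalizing n with
  | zero => exact fun v N _ => ⟨0, fun i => N.zero_mem, Subsingleton.elim _ _⟩
  | succ k ih =>
    rcases k with _ | k
    · obtain rfl : s = n := by omega
      exact hs.generatorsLift.of_linearEquiv (LinearEquiv.funUnique (Fin 1) R R).symm
    · obtain ⟨n, rfl⟩ : ∃ m, n = m + 1 := ⟨n - 1, by omega⟩
      exact (hs.generatorsLift.of_le (by omega)).pi_succ (ih (by omega))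

theorem matUnimodular_of_span_eq_top {n k : ℕ} {B : Matrix (Fin n) (Fin k) R}
    (hB : span R (Set.range fun i => B i) = ⊤) : MatUnimodular B := by
  have h : ∀ i : Fin k, ∃ c : Fin n → R, ∑ l, c l • B l = Pi.single i 1 := fun i =>
    mem_span_range_iff_exists_fun R |>.1 (hB ▸ mem_top)
  choose L hL using h
  refine ⟨Matrix.of L, ?_⟩
  ext i j
  have := congrFun (hL i) j
  simpa [Matrix.mul_apply, Matrix.one_apply, Pi.single_apply, eq_comm] using this

end GeneratorsLift

/-- The submodule of `R^k` generated by the last `l` rows of the matrix of a block and the rows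
`(f_1(m), …, f_k(m))` for `m ∈ M`. -/
def Block.lowerRows {n k l : ℕ} (A : Block R M (n + l) k) (hA : A.IsAntiLinear) :
    Submodule R (Fin k → R) where
  carrier := {x | ∃ (q : Fin l → R) (m : M),
    ∀ j, x j = ∑ t, q t * A.mat (Fin.natAdd n t) j + A.maps j m}
  zero_mem' := ⟨0, 0, fun j => by simpa using ((hA j).2 0 0).symm⟩
  add_mem' := by
    rintro x y ⟨q, m, hx⟩ ⟨q', m', hy⟩
    refine ⟨q + q', m + m', fun j => ?_⟩
    simp only [Pi.add_apply, hx, hy, (hA j).1, add_mul, Finset.sum_add_distrib]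
    abel
  smul_mem' := by
    rintro r x ⟨q, m, hx⟩
    refine ⟨r • q, op (star r) • m, fun j => ?_⟩
    rw [(hA j).2, star_star]
    simp [hx, mul_add, Finset.mul_sum, mul_assoc]

theorem Block.span_sup_lowerRows {n k l : ℕ} (A : Block R M (n + l) k) (hA : A.IsAntiLinear)
    (hAuni : A.Unimodular) :
    Submodule.span R (Set.range fun i : Fin n => A.mat (Fin.castAdd l i)) ⊔ A.lowerRows hA = ⊤ := by
  obtain ⟨r', m', h⟩ := hAuni
  rw [eq_top_iff, ← (Pi.basisFun R (Fin k)).span_eq, Submodule.span_le]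
  rintro _ ⟨i, rfl⟩
  have heq : Pi.basisFun R (Fin k) i =
      ∑ a : Fin n, r' i (Fin.castAdd l a) • A.mat (Fin.castAdd l a) +
        fun j => ∑ t : Fin l, r' i (Fin.natAdd n t) * A.mat (Fin.natAdd n t) j
          + A.maps j (m' i) := by
    ext j
    have := h i j
    rw [Fin.sum_univ_add, add_assoc] at this
    simpa [Pi.single_apply, eq_comm] using this.symm
  rw [heq]
  exact add_mem (Submodule.mem_sup_left (sum_mem fun a _ => Submodule.smul_mem _ _
      (Submodule.subset_span ⟨a, rfl⟩)))
    (Submodule.mem_sup_right ⟨_, m' i, fun j => rfl⟩)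

/-- Let `k + s = n + 1`, `l > 0` and suppose `R` satisfies the stable
range condition `(S_s)`. For every unimodular `(n+l)×k`-block `A` there are
`m_1, …, m_n ∈ M` and an `n×l` matrix `Q` over `R` such that the `n×k` matrix `B₁` with
entries `(B₁)_{i,j} = r_{i,j} + Σ_t Q_{i,t}·r_{n+t,j} + f_j(m_i)` is unimodular. -/
theorem block_reduction_first_rows (R : Type*) [Ring R] [StarRing R]
    (M : Type*) [AddCommGroup M] [Module Rᵐᵒᵖ M] (s n k l : ℕ)
    (hns : k + s = n + 1) (hl : 0 < l) (hs : SatisfiesStableRange R s)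
    (A : Block R M (n + l) k) (hA : A.IsAntiLinear) (hAuni : A.Unimodular) :
    ∃ (m : Fin n → M) (Q : Matrix (Fin n) (Fin l) R),
      MatUnimodular (Matrix.of fun (i : Fin n) (j : Fin k) =>
        A.mat (Fin.castAdd l i) j + (∑ t : Fin l, Q i t * A.mat (Fin.natAdd n t) j)
          + A.maps j (m i)) := by
  obtain ⟨x, hx, hspan⟩ := hs.generatorsLift_pi hns _ _ (A.span_sup_lowerRows hA hAuni)
  choose Q m hQm using hx
  refine ⟨m, Q, matUnimodular_of_span_eq_top ?_⟩
  rw [← hspan]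
  congr 2
  ext i j
  simp [hQm, add_assoc]
end
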